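/- For every real ε > 0 there exists a constant C > 0 (depending only on ε) such that for every integer n ≥ 2 there exists a deterministic online sorting strategy s for array size n with expected cost E_x[cost(s,x)] ≤ C · n^{ε} over an i.i.d. uniform input. (Thus stochastic online sorting admits deterministic algorithms of expected cost n^{o(1)}.) -/

import Mathlib

open MeasureTheory

/-- The distribution of `n` i.i.d. uniform samples from `[0,1]`. -/
noncomputable def uniformCube (n : ℕ) : Measure (Fin n → ℝ) :=
  Measure.pi fun _ => (volume : Measure ℝ).restrict (Set.Icc 0 1)

/-- A deterministic online sorting strategy for array size `n`: upon arrival of the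
`(k+1)`-st item, it is placed into cell `place x k`, which depends only on the first
`k+1` items and is distinct from all previously used cells. -/
structure OnlineStrategy (n : ℕ) where
  place : (Fin n → ℝ) → Fin n → Fin n
  online : ∀ x y : Fin n → ℝ, ∀ k : Fin n,
    (∀ i : Fin n, i ≤ k → x i = y i) → place x k = place y k
  inj : ∀ x : Fin n → ℝ, Function.Injective (place x)
  meas : ∀ k : Fin n, Measurable fun x => place x k

/-- The final array produced by the strategy (cells indexed `0,…,n-1`):
cell `j` holds the item inserted at the unique time `k` with `place x k = j`. -/
noncomputable def strategyArr {n : ℕ} (S : OnlineStrategy n) (x : Fin n → ℝ) (j : ℕ) : ℝ :=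
  if h : j < n then
    haveI : Nonempty (Fin n) := ⟨⟨j, h⟩⟩
    x (Function.invFun (S.place x) ⟨j, h⟩)
  else 0

/-- The cost: the sum of absolute differences between adjacent cells. -/
noncomputable def strategyCost {n : ℕ} (S : OnlineStrategy n) (x : Fin n → ℝ) : ℝ :=
  ∑ j ∈ Finset.range (n - 1), |strategyArr S x (j + 1) - strategyArr S x j|

/-- Distance between the values of two adjacent cells, zero if one of them is empty. -/
noncomputable def cellDist {α : Type*} (v : α → ℝ) : Option α → Option α → ℝ
  | some a, some b => |v a - v b|
  | _, _ => 0

/-- Cost of a partially filled array: the sum of the distances of adjacent filled cells. -/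
noncomputable def listCost {α : Type*} (v : α → ℝ) : List (Option α) → ℝ
  | [] => 0
  | [_] => 0
  | a :: b :: l => cellDist v a b + listCost v (b :: l)

/-- Number of empty cells. -/
def holes {α : Type*} (L : List (Option α)) : ℕ := L.countP Option.isNone

/-- `L'` arises from `L` by putting item `a` into an empty cell. -/
def Placed {α : Type*} (a : α) (L L' : List (Option α)) : Prop :=
  ∃ l₁ l₂, L = l₁ ++ none :: l₂ ∧ L' = l₁ ++ some a :: l₂

/-- The `r` empty cells of `L` can be filled online with `r` i.i.d. uniform items from the finite
alphabet `α`, such that the final array has expected cost at most `c`. -/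
def Fillable {α : Type*} [Fintype α] (v : α → ℝ) : ℕ → List (Option α) → ℝ → Prop
  | 0, L, c => holes L = 0 ∧ listCost v L ≤ c
  | r + 1, L, c => ∃ f : α → ℝ, ∑ a, f a ≤ c * Fintype.card α ∧
      ∀ a, ∃ L', Placed a L L' ∧ Fillable v r L' (f a)

section Basic

variable {α : Type*} {v : α → ℝ}

lemma cellDist_nonneg (x y : Option α) : 0 ≤ cellDist v x y := by
  cases x <;> cases y <;> simp [cellDist]

@[simp] lemma cellDist_none_left (y : Option α) : cellDist v none y = 0 := by
  cases y <;> rfl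

@[simp] lemma cellDist_none_right (x : Option α) : cellDist v x none = 0 := by
  cases x <;> rfl

lemma cellDist_le {δ : ℝ} (hδ : ∀ a b, |v a - v b| ≤ δ) (h0 : 0 ≤ δ) (x y : Option α) :
    cellDist v x y ≤ δ := by
  cases x <;> cases y <;> simp [cellDist, h0, hδ]

lemma listCost_cons_cons (a b : Option α) (l : List (Option α)) :
    listCost v (a :: b :: l) = cellDist v a b + listCost v (b :: l) := rfl

lemma listCost_nonneg (l : List (Option α)) : 0 ≤ listCost v l := by
  induction l with
  | nil => simp [listCost]
  | cons a l ih =>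
    cases l with
    | nil => simp [listCost]
    | cons b l =>
      rw [listCost_cons_cons]
      exact add_nonneg (cellDist_nonneg _ _) ih

lemma listCost_append_cons (l₁ l₂ : List (Option α)) (x : Option α) :
    listCost v (l₁ ++ x :: l₂) = listCost v (l₁ ++ [x]) + listCost v (x :: l₂) := by
  induction l₁ with
  | nil => simp [listCost]
  | cons a l ih =>
    cases l with
    | nil => simp [listCost]
    | cons b l =>
      simp only [List.cons_append, listCost_cons_cons] at ih ⊢
      rw [ih]; ring

lemma listCost_append_le {δ : ℝ} (hδ : ∀ a b, |v a - v b| ≤ δ) (h0 : 0 ≤ δ)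
    (l₁ l₂ : List (Option α)) :
    listCost v (l₁ ++ l₂) ≤ listCost v l₁ + listCost v l₂ + δ := by
  induction l₁ with
  | nil => simp [listCost, h0]
  | cons a l ih =>
    cases l with
    | nil =>
      cases l₂ with
      | nil => simp [listCost, h0]
      | cons b l =>
        have := cellDist_le hδ h0 a b
        simp only [List.cons_append, List.nil_append, listCost_cons_cons, listCost]
        linarith
    | cons b l =>
      simp only [List.cons_append, listCost_cons_cons] at ih ⊢
      linarith

lemma listCost_none_cons (l : List (Option α)) : listCost v (none :: l) = listCost v l := by
  cases l <;> simp [listCost]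

lemma listCost_cons_le {δ : ℝ} (hδ : ∀ a b, |v a - v b| ≤ δ) (h0 : 0 ≤ δ) (x : Option α)
    (l : List (Option α)) : listCost v (x :: l) ≤ listCost v l + δ := by
  cases l with
  | nil => simp [listCost, h0]
  | cons b l =>
    have := cellDist_le hδ h0 x b
    rw [listCost_cons_cons]; linarith

lemma listCost_le_cons (x : Option α) (l : List (Option α)) :
    listCost v l ≤ listCost v (x :: l) := by
  cases l with
  | nil => simp [listCost]
  | cons b l =>
    have := cellDist_nonneg (v := v) x b
    rw [listCost_cons_cons]; linarith

lemma listCost_concat_none (l : List (Option α)) : listCost v (l ++ [none]) = listCost v l := by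
  induction l with
  | nil => simp [listCost]
  | cons a l ih =>
    cases l with
    | nil => simp [listCost]
    | cons b l =>
      simp only [List.cons_append, listCost_cons_cons] at ih ⊢
      rw [ih]

lemma listCost_le_append (l₁ l₂ : List (Option α)) : listCost v l₁ ≤ listCost v (l₁ ++ l₂) := by
  induction l₁ with
  | nil => simpa [listCost] using listCost_nonneg l₂
  | cons a l ih =>
    cases l with
    | nil => simpa [listCost] using listCost_nonneg _
    | cons b l =>
      simp only [List.cons_append, listCost_cons_cons] at ih ⊢
      linarith

lemma Placed.le_listCost {a : α} {L L' : List (Option α)} (h : Placed a L L') :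
    listCost v L ≤ listCost v L' := by
  obtain ⟨l₁, l₂, rfl, rfl⟩ := h
  rw [listCost_append_cons, listCost_append_cons l₁ l₂ (some a), listCost_concat_none,
    listCost_none_cons]
  exact add_le_add (listCost_le_append _ _) (listCost_le_cons _ _)

lemma Placed.listCost_le {δ : ℝ} (hδ : ∀ a b, |v a - v b| ≤ δ) (h0 : 0 ≤ δ) {a : α}
    {L L' : List (Option α)} (h : Placed a L L') : listCost v L' ≤ listCost v L + 2 * δ := by
  obtain ⟨l₁, l₂, rfl, rfl⟩ := h
  rw [listCost_append_cons, listCost_append_cons l₁ l₂ none, listCost_concat_none,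
    listCost_none_cons]
  have h₁ := listCost_append_le hδ h0 l₁ [some a]
  have h₂ := listCost_cons_le hδ h0 (some a) l₂
  simp only [listCost] at h₁
  linarith

lemma Placed.holes_eq {a : α} {L L' : List (Option α)} (h : Placed a L L') :
    holes L = holes L' + 1 := by
  obtain ⟨l₁, l₂, rfl, rfl⟩ := h
  simp [holes]; ring

lemma Placed.append {a : α} {L L' : List (Option α)} (h : Placed a L L')
    (l r : List (Option α)) : Placed a (l ++ L ++ r) (l ++ L' ++ r) := by
  obtain ⟨l₁, l₂, rfl, rfl⟩ := h
  exact ⟨l ++ l₁, l₂ ++ r, by simp, by simp⟩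

lemma Placed.map {β : Type*} {a : α} {L L' : List (Option α)} (h : Placed a L L') (g : α → β) :
    Placed (g a) (L.map (Option.map g)) (L'.map (Option.map g)) := by
  obtain ⟨l₁, l₂, rfl, rfl⟩ := h
  exact ⟨l₁.map (Option.map g), l₂.map (Option.map g), by simp, by simp⟩

lemma exists_placed {L : List (Option α)} (h : holes L ≠ 0) (a : α) : ∃ L', Placed a L L' := by
  have : none ∈ L := by
    by_contra hn
    apply h
    rw [holes, List.countP_eq_zero]
    intro x hx
    cases x with
    | none => exact absurd hx hn
    | some x => simp
  obtain ⟨l₁, l₂, rfl⟩ := List.append_of_mem this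
  exact ⟨_, l₁, l₂, rfl, rfl⟩

lemma holes_append (l₁ l₂ : List (Option α)) : holes (l₁ ++ l₂) = holes l₁ + holes l₂ := by
  simp [holes]

lemma holes_map {β : Type*} (g : α → β) (l : List (Option α)) :
    holes (l.map (Option.map g)) = holes l := by
  simp [holes, List.countP_map, Function.comp_def]

lemma holes_replicate (n : ℕ) : holes (List.replicate n (none : Option α)) = n := by
  simp [holes, List.countP_replicate]

lemma listCost_replicate (n : ℕ) : listCost v (List.replicate n (none : Option α)) = 0 := by
  induction n with
  | zero => rfl
  | succ n ih => rw [List.replicate_succ, listCost_none_cons, ih]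

lemma listCost_map {β : Type*} {u : β → ℝ} {g : α → β} {c : ℝ}
    (h : ∀ a b, |u (g a) - u (g b)| = c * |v a - v b|) (l : List (Option α)) :
    listCost u (l.map (Option.map g)) = c * listCost v l := by
  induction l with
  | nil => simp [listCost]
  | cons a l ih =>
    cases l with
    | nil => simp [listCost]
    | cons b l =>
      simp only [List.map_cons, listCost_cons_cons] at ih ⊢
      rw [ih, mul_add]
      congr 1
      cases a <;> cases b <;> simp [cellDist, h]

lemma holes_flatten (Ls : List (List (Option α))) :
    holes Ls.flatten = (Ls.map holes).sum := by
  induction Ls with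
  | nil => rfl
  | cons l Ls ih => simp [holes_append, ih]

lemma listCost_flatten_le (hv : ∀ a b, |v a - v b| ≤ 1) (Ls : List (List (Option α))) :
    listCost v Ls.flatten ≤ (Ls.map (listCost v)).sum + Ls.length := by
  induction Ls with
  | nil => simp [listCost]
  | cons l Ls ih =>
    have := listCost_append_le hv zero_le_one l Ls.flatten
    simp only [List.flatten_cons, List.map_cons, List.sum_cons, List.length_cons]
    push_cast
    linarith

variable [Fintype α]

lemma Fillable.mono {r : ℕ} {L : List (Option α)} {c c' : ℝ} (h : Fillable v r L c)
    (hc : c ≤ c') : Fillable v r L c' := by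
  cases r with
  | zero => exact ⟨h.1, h.2.trans hc⟩
  | succ r =>
    obtain ⟨f, hf, h⟩ := h
    exact ⟨f, hf.trans (by gcongr), h⟩

lemma Fillable.holes_eq [Nonempty α] {r : ℕ} {L : List (Option α)} {c : ℝ}
    (h : Fillable v r L c) : holes L = r := by
  induction r generalizing L c with
  | zero => exact h.1
  | succ r ih =>
    obtain ⟨f, -, h⟩ := h
    obtain ⟨L', hp, hL'⟩ := h (Classical.arbitrary α)
    rw [hp.holes_eq, ih hL']

lemma Fillable.listCost_le [Nonempty α] {r : ℕ} {L : List (Option α)} {c : ℝ}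
    (h : Fillable v r L c) : listCost v L ≤ c := by
  induction r generalizing L c with
  | zero => exact h.2
  | succ r ih =>
    obtain ⟨f, hf, h⟩ := h
    have h1 : ∀ a ∈ Finset.univ, listCost v L ≤ f a := fun a _ => by
      obtain ⟨L', hp, hL'⟩ := h a
      exact hp.le_listCost.trans (ih hL')
    have h2 := Finset.card_nsmul_le_sum _ _ _ h1
    rw [nsmul_eq_mul, Finset.card_univ, mul_comm] at h2
    exact le_of_mul_le_mul_right (h2.trans hf) (by exact_mod_cast Fintype.card_pos)

lemma fillable_of_dist_le {δ : ℝ} (hδ : ∀ a b, |v a - v b| ≤ δ) (h0 : 0 ≤ δ) {r : ℕ}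
    {L : List (Option α)} (hL : holes L = r) :
    Fillable v r L (listCost v L + 2 * δ * r) := by
  induction r generalizing L with
  | zero => exact ⟨hL, by simp⟩
  | succ r ih =>
    refine ⟨fun _ => listCost v L + 2 * δ * (r + 1 : ℕ), ?_, fun a => ?_⟩
    · rw [Finset.sum_const, Finset.card_univ, nsmul_eq_mul, mul_comm]
    obtain ⟨L', hp⟩ := exists_placed (L := L) (by omega) a
    refine ⟨L', hp, (ih (by have := hp.holes_eq; omega)).mono ?_⟩
    have := hp.listCost_le hδ h0
    push_cast
    linarith

lemma Fillable.map_equiv {β : Type*} [Fintype β] {u : β → ℝ} (e : α ≃ β)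
    (he : ∀ a, u (e a) = v a) {r : ℕ} {L : List (Option α)} {c : ℝ} (h : Fillable v r L c) :
    Fillable u r (L.map (Option.map e)) c := by
  induction r generalizing L c with
  | zero =>
    refine ⟨by rw [holes_map, h.1], ?_⟩
    rw [listCost_map (v := v) (c := 1) (by simp [he]), one_mul]
    exact h.2
  | succ r ih =>
    obtain ⟨f, hf, h⟩ := h
    refine ⟨fun b => f (e.symm b), ?_, fun b => ?_⟩
    · rw [Equiv.sum_comp e.symm f, ← Fintype.card_congr e]
      exact hf
    · obtain ⟨L', hp, hL'⟩ := h (e.symm b)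
      exact ⟨_, by simpa using hp.map e, ih hL'⟩

end Basic

/-- The collection `S` of partially filled segments can be filled online with expected cost at
most `c`, where in addition to `c` every segment may contribute a cost of `1`. -/
def SegFillable {β : Type*} [Fintype β] (u : β → ℝ) (r : ℕ) (S : Multiset (List (Option β)))
    (c : ℝ) : Prop :=
  ∀ Ls : List (List (Option β)), (Ls : Multiset (List (Option β))) = S →
    Fillable u r Ls.flatten (c + Ls.length)

section Segments

variable {β : Type*} [Fintype β] {u : β → ℝ} {r : ℕ} {S : Multiset (List (Option β))} {c : ℝ}

lemma SegFillable.mono {c' : ℝ} (h : SegFillable u r S c) (hc : c ≤ c') :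
    SegFillable u r S c' := fun Ls hLs => (h Ls hLs).mono (by linarith)

lemma exists_eq_append_of_coe_eq_cons {γ : Type*} {Ls : List γ} {s : γ} {S : Multiset γ}
    (h : (Ls : Multiset γ) = s ::ₘ S) :
    ∃ l₁ l₂, Ls = l₁ ++ s :: l₂ ∧ ((l₁ ++ l₂ : List γ) : Multiset γ) = S := by
  have : s ∈ Ls := by rw [← Multiset.mem_coe, h]; simp
  obtain ⟨l₁, l₂, rfl⟩ := List.append_of_mem this
  refine ⟨l₁, l₂, rfl, ?_⟩
  rw [← Multiset.cons_inj_right s, ← h, Multiset.cons_coe, Multiset.coe_eq_coe]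
  exact List.perm_middle.symm

lemma SegFillable.of_split {x y : List (Option β)} (h : SegFillable u r (x ::ₘ y ::ₘ S) c) :
    SegFillable u r ((x ++ y) ::ₘ S) (c + 1) := by
  intro Ls hLs
  obtain ⟨l₁, l₂, rfl, rfl⟩ := exists_eq_append_of_coe_eq_cons hLs
  have := h (l₁ ++ x :: y :: l₂) (by
    simp only [Multiset.cons_coe, Multiset.coe_eq_coe]
    exact List.perm_middle.trans (List.Perm.cons _ List.perm_middle))
  refine Fillable.mono (c := c + (l₁ ++ x :: y :: l₂).length) (by simpa using this) ?_
  simp; linarith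

lemma SegFillable.step (f : β → ℝ) (hf : ∑ b, f b ≤ c * Fintype.card β)
    (h : ∀ b, ∃ s s' S₀, S = s ::ₘ S₀ ∧ Placed b s s' ∧ SegFillable u r (s' ::ₘ S₀) (f b)) :
    SegFillable u (r + 1) S c := by
  intro Ls hLs
  refine ⟨fun b => f b + Ls.length, ?_, fun b => ?_⟩
  · rw [Finset.sum_add_distrib, Finset.sum_const, Finset.card_univ, nsmul_eq_mul]
    linarith
  · obtain ⟨s, s', S₀, rfl, hp, hS⟩ := h b
    obtain ⟨l₁, l₂, rfl, rfl⟩ := exists_eq_append_of_coe_eq_cons hLs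
    have := hS (l₁ ++ s' :: l₂) (by
      simp only [Multiset.cons_coe, Multiset.coe_eq_coe]
      exact List.perm_middle)
    refine ⟨(l₁ ++ s' :: l₂).flatten, ?_, by simpa using this⟩
    simpa using hp.append l₁.flatten l₂.flatten

lemma segFillable_of_holes (hu : ∀ a b, |u a - u b| ≤ 1) (hr : (S.map holes).sum = r) :
    SegFillable u r S ((S.map (listCost u)).sum + 2 * r) := by
  rintro Ls rfl
  have h1 := listCost_flatten_le hu Ls
  refine (fillable_of_dist_le hu zero_le_one (r := r) ?_).mono ?_
  · rw [holes_flatten]; simpa using hr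
  · simp only [Multiset.map_coe, Multiset.sum_coe]
    linarith

end Segments

section Potential

lemma potential_claim_le {K b R : ℕ} (hK : 1 ≤ K) (hb : 2 * K * b ≤ R) :
    (4 : ℝ) ^ b * (1 - 3 / (4 * K)) ^ R ≤ 1 := by
  have hK0 : (1 : ℝ) ≤ K := by exact_mod_cast hK
  have hq0 : (0 : ℝ) ≤ 1 - 3 / (4 * K) := by
    rw [sub_nonneg, div_le_one (by positivity)]; linarith
  have h1 : (1 : ℝ) - 3 / (4 * K) ≤ Real.exp (-(3 / (4 * K))) := by
    have := Real.add_one_le_exp (-(3 / (4 * K) : ℝ)); linarith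
  have h2 : ((1 : ℝ) - 3 / (4 * K)) ^ R ≤ Real.exp (-(3 / 2)) ^ b := by
    calc ((1 : ℝ) - 3 / (4 * K)) ^ R ≤ (1 - 3 / (4 * K)) ^ (2 * K * b) :=
          pow_le_pow_of_le_one hq0 (by rw [sub_le_self_iff]; positivity) hb
      _ ≤ Real.exp (-(3 / (4 * K))) ^ (2 * K * b) := by gcongr
      _ = Real.exp (-(3 / 2)) ^ b := by
          rw [pow_mul, ← Real.exp_nat_mul]
          congr 2
          push_cast
          field_simp
          ring
  have h4 : (4 : ℝ) * Real.exp (-(3 / 2)) ≤ 1 := by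
    rw [Real.exp_neg, ← div_eq_mul_inv, div_le_one (Real.exp_pos _)]
    have h5 : Real.exp (3 / 2) ^ 2 = Real.exp 1 ^ 3 := by
      rw [← Real.exp_nat_mul, ← Real.exp_nat_mul]; norm_num
    have h6 : (2.7 : ℝ) ^ 3 ≤ Real.exp 1 ^ 3 := by
      have := Real.exp_one_gt_d9
      gcongr; linarith
    refine le_of_sq_le_sq ?_ (Real.exp_pos _).le
    rw [h5]
    refine le_trans ?_ h6
    norm_num
  calc (4 : ℝ) ^ b * (1 - 3 / (4 * K)) ^ R ≤ 4 ^ b * Real.exp (-(3 / 2)) ^ b := by gcongr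
    _ = (4 * Real.exp (-(3 / 2))) ^ b := (mul_pow _ _ _).symm
    _ ≤ 1 := pow_le_one₀ (by positivity) h4

lemma two_mul_le_potential {K U R : ℕ} (hK : 2 ≤ K) (h : Fin K → ℕ) (hU : U < 2 * K)
    (hR : R = U + ∑ j, h j) :
    2 * (R : ℝ) ≤ ∑ j, 320 * (4 : ℝ) ^ h j * (1 - 3 / (4 * K)) ^ R := by
  have hK0 : (2 : ℝ) ≤ K := by exact_mod_cast hK
  have hq0 : (0 : ℝ) ≤ 1 - 3 / (4 * K) := by
    rw [sub_nonneg, div_le_one (by positivity)]; linarith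
  set L := Real.log 4 with hL
  have hL1 : 1.38 ≤ L := by
    have h1 : L = 2 * Real.log 2 := by
      rw [hL, show (4 : ℝ) = 2 ^ 2 by norm_num, Real.log_pow]; norm_num
    have := Real.log_two_gt_d9
    rw [h1]; linarith
  have hexp (x : ℝ) (m : ℕ) : Real.exp (x * L) * (1 + (m - x) * L) ≤ (4 : ℝ) ^ m := by
    have h1 : (4 : ℝ) ^ m = Real.exp (x * L) * Real.exp ((m - x) * L) := by
      rw [← Real.exp_add, show x * L + (m - x) * L = m * L by ring, Real.exp_nat_mul,
        Real.exp_log (by norm_num)]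
    rw [h1]
    gcongr
    have := Real.add_one_le_exp ((m - x) * L)
    linarith
  set x : ℝ := (∑ j, (h j : ℝ)) / K with hx
  have hxK : ∑ j, (h j : ℝ) = K * x := by rw [hx]; field_simp
  have h2 : K * Real.exp (x * L) ≤ ∑ j, (4 : ℝ) ^ h j := by
    refine le_trans (le_of_eq ?_) (Finset.sum_le_sum fun j _ => hexp x (h j))
    rw [← Finset.mul_sum, Finset.sum_add_distrib, ← Finset.sum_mul, Finset.sum_sub_distrib, hxK]
    simp; ring
  have hRx : (R : ℝ) / K ≤ x + 2 := by
    rw [div_le_iff₀ (by positivity), add_mul, mul_comm x, ← hxK, hR]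
    push_cast
    have : (U : ℝ) ≤ 2 * K := by exact_mod_cast hU.le
    linarith
  have h3 : Real.exp (L / K) ^ R ≤ 16 * Real.exp (x * L) := by
    have : (16 : ℝ) = Real.exp (2 * L) := by
      rw [show (2 : ℝ) * L = (2 : ℕ) * L by norm_num, Real.exp_nat_mul,
        Real.exp_log (by norm_num)]; norm_num
    rw [this, ← Real.exp_add, ← Real.exp_nat_mul]
    refine Real.exp_le_exp.2 ?_
    have : (R : ℝ) * (L / K) = R / K * L := by ring
    rw [this]
    nlinarith
  have h4 : 1 + 1 / (10 * K : ℝ) ≤ Real.exp (L / K) * (1 - 3 / (4 * K)) := by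
    have h5 := Real.add_one_le_exp (L / K)
    have h6 : (L / K + 1) * (1 - 3 / (4 * K)) ≤ Real.exp (L / K) * (1 - 3 / (4 * K)) := by gcongr
    refine le_trans ?_ h6
    have hp : (1 : ℝ) / K ≤ 1 / 2 := by
      rw [div_le_div_iff₀ (by positivity) (by norm_num)]; linarith
    have hp0 : (0 : ℝ) < 1 / K := by positivity
    rw [show (1 : ℝ) / (10 * K) = 1 / 10 * (1 / K) by field_simp,
      show L / K = L * (1 / K) by ring, show (3 : ℝ) / (4 * K) = 3 / 4 * (1 / K) by field_simp]
    set p : ℝ := 1 / K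
    nlinarith [mul_pos hp0 hp0, mul_nonneg hp0.le (sub_nonneg.2 hp),
      mul_nonneg (mul_nonneg hp0.le (sub_nonneg.2 hp)) (sub_nonneg.2 hL1)]
  have h7 : 1 + (R : ℝ) * (1 / (10 * K)) ≤ (1 + 1 / (10 * K : ℝ)) ^ R :=
    one_add_mul_le_pow (by have : (0 : ℝ) ≤ 1 / (10 * K) := by positivity
                           linarith) R
  have h8 : (1 + 1 / (10 * K : ℝ)) ^ R ≤ 16 * Real.exp (x * L) * (1 - 3 / (4 * K)) ^ R := by
    calc (1 + 1 / (10 * K : ℝ)) ^ R ≤ (Real.exp (L / K) * (1 - 3 / (4 * K))) ^ R := by gcongr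
      _ = Real.exp (L / K) ^ R * (1 - 3 / (4 * K)) ^ R := mul_pow _ _ _
      _ ≤ _ := by gcongr
  rw [← Finset.sum_mul, ← Finset.mul_sum]
  have h9 : K * Real.exp (x * L) * (1 - 3 / (4 * K)) ^ R ≤
      (∑ j, (4 : ℝ) ^ h j) * (1 - 3 / (4 * K)) ^ R := by gcongr
  have h10 : (R : ℝ) / 10 ≤ 16 * (K * Real.exp (x * L) * (1 - 3 / (4 * K)) ^ R) := by
    have := mul_le_mul_of_nonneg_left (h7.trans h8) (by positivity : (0 : ℝ) ≤ K)
    have e : (K : ℝ) * (1 + R * (1 / (10 * K))) = K + R / 10 := by field_simp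
    rw [e] at this
    linarith
  linarith

lemma log_sub_div_le {K U : ℕ} (hK : 2 ≤ K) (hU : 2 * K ≤ U) :
    4 * K * Real.log (U - U / (2 * K) : ℕ) + 1 ≤ 4 * K * Real.log U := by
  set b := U / (2 * K) with hb
  have hb1 : 1 ≤ b := (Nat.one_le_div_iff (by omega)).2 hU
  have hbU : 2 * K * b ≤ U := Nat.mul_div_le _ _
  have hb2 : U < 2 * K * (b + 1) := Nat.lt_mul_div_succ _ (by omega)
  have hlt : b < U := by nlinarith
  have hK0 : (2 : ℝ) ≤ K := by exact_mod_cast hK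
  have hU0 : (0 : ℝ) < U := by exact_mod_cast (by omega : 0 < U)
  have h4 : (U : ℝ) ≤ 4 * K * b := by
    have : U ≤ 4 * K * b := by nlinarith
    exact_mod_cast this
  have hpos : (0 : ℝ) < (U - b : ℕ) := by exact_mod_cast (by omega : 0 < U - b)
  have h5 : Real.log ((U - b : ℕ) / U) ≤ ((U - b : ℕ) : ℝ) / U - 1 :=
    Real.log_le_sub_one_of_pos (by positivity)
  rw [Real.log_div hpos.ne' hU0.ne', Nat.cast_sub hlt.le, sub_div, div_self hU0.ne'] at h5
  have h6 : 1 ≤ 4 * K * ((b : ℝ) / U) := by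
    rw [← mul_div_assoc, le_div_iff₀ hU0]; linarith
  rw [Nat.cast_sub hlt.le]
  nlinarith

end Potential

lemma sum_update_eq {ι M : Type*} {γ : ι → Type*} [Fintype ι] [DecidableEq ι] [AddCommMonoid M]
    (F : ∀ i, γ i → M) (A : ∀ i, γ i) (j : ι) (x : γ j) :
    ∑ i, F i (Function.update A j x i) = F j x + ∑ i ∈ Finset.univ.erase j, F i (A i) := by
  rw [← Finset.add_sum_erase _ _ (Finset.mem_univ j), Function.update_self]
  congr 1
  refine Finset.sum_congr rfl fun i hi => ?_
  rw [Function.update_of_ne (Finset.ne_of_mem_erase hi)]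

section Buckets

variable {α : Type*} {v : α → ℝ} {K : ℕ} {u : Fin K × α → ℝ}

/-- Bucket `j` fills its current segment `A j`, the segments in `Cl` are full, and `U` cells are
not yet assigned to any bucket. -/
def bucketState (A : Fin K → List (Option α)) (Cl : Multiset (List (Option (Fin K × α))))
    (U : ℕ) : Multiset (List (Option (Fin K × α))) :=
  List.replicate U none ::ₘ (Cl + ∑ j, {(A j).map (Option.map (Prod.mk j))})

/-- Bound for the expected cost of completing a state of the bucket algorithm. -/
noncomputable def bucketPotential (u : Fin K × α → ℝ) (T : ℝ) (φ : Fin K → ℝ) (h : Fin K → ℕ)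
    (Cl : Multiset (List (Option (Fin K × α)))) (U : ℕ) : ℝ :=
  (Cl.map (listCost u)).sum + (∑ j, φ j) / K +
    (∑ j, 320 * (4 : ℝ) ^ h j * (1 - 3 / (4 * K)) ^ (U + ∑ j, h j)) +
    (T / K + 321) * (4 * K * Real.log U)

lemma bucketState_eq_cons (A : Fin K → List (Option α))
    (Cl : Multiset (List (Option (Fin K × α)))) (U : ℕ) (j : Fin K) (x : List (Option α)) :
    bucketState (Function.update A j x) Cl U = x.map (Option.map (Prod.mk j)) ::ₘ
      List.replicate U none ::ₘ
        (Cl + ∑ i ∈ Finset.univ.erase j, {(A i).map (Option.map (Prod.mk i))}) := by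
  rw [bucketState, sum_update_eq (fun i y => {List.map (Option.map (Prod.mk i)) y}),
    Multiset.cons_swap, Multiset.singleton_add, Multiset.add_cons]

variable {T : ℝ}

lemma bucketPotential_claim (hK : 2 ≤ K) (hT0 : 0 ≤ T)
    (huj : ∀ j a b, |u (j, a) - u (j, b)| = 1 / K * |v a - v b|)
    {A : Fin K → List (Option α)} {φ : Fin K → ℝ} {h : Fin K → ℕ}
    {Cl : Multiset (List (Option (Fin K × α)))} {U : ℕ} {j : Fin K} (hj : h j = 0)
    (hφ : listCost v (A j) ≤ φ j) (hU : 2 * K ≤ U) :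
    bucketPotential u T (Function.update φ j T) (Function.update h j (U / (2 * K)))
      ((A j).map (Option.map (Prod.mk j)) ::ₘ Cl) (U - U / (2 * K)) + 1 ≤
    bucketPotential u T φ h Cl U := by
  have hK0 : (2 : ℝ) ≤ K := by exact_mod_cast hK
  have hle : U / (2 * K) ≤ U := Nat.div_le_self _ _
  have hsum : U - U / (2 * K) + ∑ i, Function.update h j (U / (2 * K)) i = U + ∑ i, h i := by
    rw [sum_update_eq (fun _ y => y), ← Finset.add_sum_erase _ h (Finset.mem_univ j), hj]
    omega
  have hq0 : (0 : ℝ) ≤ 1 - 3 / (4 * K) := by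
    rw [sub_nonneg, div_le_one (by positivity)]; linarith
  have h1 := potential_claim_le (K := K) (b := U / (2 * K)) (R := U + ∑ i, h i) (by omega)
    ((Nat.mul_div_le _ _).trans (by omega))
  have h2 := mul_le_mul_of_nonneg_left (log_sub_div_le hK hU)
    (by positivity : 0 ≤ T / K + 321)
  have h3 : listCost u ((A j).map (Option.map (Prod.mk j))) ≤ φ j / K := by
    rw [listCost_map (huj j), one_div, inv_mul_eq_div]
    gcongr
  rw [bucketPotential, bucketPotential, hsum, sum_update_eq (fun _ y => y),
    sum_update_eq (fun _ y => 320 * (4 : ℝ) ^ y * (1 - 3 / (4 * K)) ^ (U + ∑ j, h j)),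
    ← Finset.add_sum_erase _ φ (Finset.mem_univ j),
    ← Finset.add_sum_erase _ (fun i => 320 * (4 : ℝ) ^ h i * (1 - 3 / (4 * K)) ^ (U + ∑ j, h j))
      (Finset.mem_univ j), Multiset.map_cons, Multiset.sum_cons, add_div, add_div]
  have h4 : 0 ≤ 320 * (4 : ℝ) ^ h j * (1 - 3 / (4 * K)) ^ (U + ∑ j, h j) := by positivity
  linarith

variable [Fintype α]

lemma bucketPotential_item (hK : 2 ≤ K) {φ : Fin K → ℝ} {h : Fin K → ℕ}
    {Cl : Multiset (List (Option (Fin K × α)))} {U : ℕ} (hh : ∀ j, h j ≠ 0)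
    {f : Fin K → α → ℝ} (hf : ∀ j, ∑ a, f j a ≤ φ j * Fintype.card α) :
    ∑ x : Fin K × α, bucketPotential u T (Function.update φ x.1 (f x.1 x.2))
      (Function.update h x.1 (h x.1 - 1)) Cl U ≤
    bucketPotential u T φ h Cl U * Fintype.card (Fin K × α) := by
  have hK0 : (2 : ℝ) ≤ K := by exact_mod_cast hK
  obtain ⟨R, hR⟩ : ∃ R, U + ∑ j, h j = R + 1 := by
    have : h ⟨0, by omega⟩ ≤ ∑ j, h j := Finset.single_le_sum (by simp) (Finset.mem_univ _)
    exact Nat.exists_eq_succ_of_ne_zero (by have := hh ⟨0, by omega⟩; omega)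
  have hsum (j : Fin K) : U + ∑ i, Function.update h j (h j - 1) i = R := by
    rw [← Finset.add_sum_erase _ h (Finset.mem_univ j)] at hR
    rw [sum_update_eq (fun _ y => y)]
    have := hh j
    omega
  set q : ℝ := 1 - 3 / (4 * K) with hq
  set c := (Cl.map (listCost u)).sum + (∑ j, φ j) / K + (∑ j, 320 * (4 : ℝ) ^ h j * q ^ R) +
    (T / K + 321) * (4 * K * Real.log U) with hc
  have hterm (j : Fin K) (a : α) : bucketPotential u T (Function.update φ j (f j a))
      (Function.update h j (h j - 1)) Cl U =
      c + (f j a - φ j) / K - 240 * (4 : ℝ) ^ h j * q ^ R := by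
    rw [bucketPotential, hsum, sum_update_eq (fun _ y => y),
      sum_update_eq (fun _ y => 320 * (4 : ℝ) ^ y * (1 - 3 / (4 * K)) ^ R), hc,
      ← Finset.add_sum_erase _ φ (Finset.mem_univ j),
      ← Finset.add_sum_erase _ (fun i => 320 * (4 : ℝ) ^ h i * q ^ R) (Finset.mem_univ j), ← hq]
    obtain ⟨m, hm⟩ := Nat.exists_eq_succ_of_ne_zero (hh j)
    simp only [hm, Nat.succ_eq_add_one, Nat.add_sub_cancel, pow_succ]
    ring
  have hcard : (0 : ℝ) ≤ Fintype.card α := by positivity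
  have hrow (j : Fin K) : ∑ a, bucketPotential u T (Function.update φ j (f j a))
      (Function.update h j (h j - 1)) Cl U ≤
      (c - 240 * (4 : ℝ) ^ h j * q ^ R) * Fintype.card α := by
    simp only [hterm]
    rw [Finset.sum_sub_distrib, Finset.sum_add_distrib, ← Finset.sum_div,
      Finset.sum_sub_distrib]
    simp only [Finset.sum_const, Finset.card_univ, nsmul_eq_mul]
    have : (∑ a, f j a - Fintype.card α * φ j) / K ≤ 0 :=
      div_nonpos_of_nonpos_of_nonneg (by linarith [hf j]) (by positivity)
    linarith
  rw [Fintype.sum_prod_type]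
  refine (Finset.sum_le_sum fun j _ => hrow j).trans (le_of_eq ?_)
  rw [← Finset.sum_mul, Finset.sum_sub_distrib, Fintype.card_prod, Fintype.card_fin,
    bucketPotential, hR, ← hq, hc]
  simp only [← Finset.sum_mul, ← Finset.mul_sum, pow_succ, Finset.sum_const, Finset.card_univ,
    nsmul_eq_mul, Fintype.card_fin]
  push_cast
  generalize (∑ i, (4 : ℝ) ^ h i) = s
  have e : (K : ℝ) * (1 - q) = 3 / 4 := by rw [hq]; field_simp; ring
  linear_combination (320 * s * q ^ R * Fintype.card α) * e

variable [Nonempty α]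

lemma segFillable_bucketState (hK : 2 ≤ K) (hT0 : 0 ≤ T) (hu1 : ∀ x y, |u x - u y| ≤ 1)
    (huj : ∀ j a b, |u (j, a) - u (j, b)| = 1 / K * |v a - v b|) {N : ℕ}
    (hT : ∀ m ≤ N, Fillable v m (List.replicate m none) T) (s : ℕ) :
    ∀ (U : ℕ) (A : Fin K → List (Option α)) (φ : Fin K → ℝ) (h : Fin K → ℕ)
      (Cl : Multiset (List (Option (Fin K × α)))), U ≤ N → (∀ j, Fillable v (h j) (A j) (φ j)) →
      (Cl.map holes).sum = 0 → 2 * U + ∑ j, h j ≤ s →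
      SegFillable u (U + ∑ j, h j) (bucketState A Cl U) (bucketPotential u T φ h Cl U) := by
  have hK0 : (2 : ℝ) ≤ K := by exact_mod_cast hK
  induction s with
  | zero => ?_
  | succ s ih => ?_
  all_goals
    intro U A φ h Cl hUN hA hCl hs
    by_cases hU : U < 2 * K
    · refine (segFillable_of_holes hu1 ?_).mono ?_
      · have : (Multiset.map holes (∑ j, {(A j).map (Option.map (Prod.mk j))})).sum =
            ∑ j, h j := by
          simp only [← Multiset.coe_mapAddMonoidHom, ← Multiset.coe_sumAddMonoidHom, map_sum]
          simp [holes_map, (hA _).holes_eq]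
        simp [bucketState, holes_replicate, hCl, this]
      · have : (Multiset.map (listCost u) (∑ j, {(A j).map (Option.map (Prod.mk j))})).sum ≤
            (∑ j, φ j) / K := by
          simp only [← Multiset.coe_mapAddMonoidHom, ← Multiset.coe_sumAddMonoidHom, map_sum]
          rw [Finset.sum_div]
          refine Finset.sum_le_sum fun j _ => ?_
          simp only [Multiset.coe_mapAddMonoidHom, Multiset.map_singleton,
            Multiset.coe_sumAddMonoidHom, Multiset.sum_singleton]
          rw [listCost_map (huj j), one_div, inv_mul_eq_div]
          have := (hA j).listCost_le
          gcongr
        have h2 := two_mul_le_potential hK h hU rfl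
        have h3 : 0 ≤ (T / K + 321) * (4 * K * Real.log U) :=
          mul_nonneg (by positivity) (mul_nonneg (by positivity) (Real.log_natCast_nonneg _))
        rw [bucketState, Multiset.map_cons, Multiset.sum_cons, listCost_replicate,
          Multiset.map_add, Multiset.sum_add, bucketPotential]
        linarith
  · omega
  · have hb1 : 1 ≤ U / (2 * K) := (Nat.one_le_div_iff (by omega)).2 (by omega)
    have hle : U / (2 * K) ≤ U := Nat.div_le_self _ _
    by_cases hh : ∃ j, h j = 0
    · obtain ⟨j, hj⟩ := hh
      have hsum : U - U / (2 * K) + ∑ i, Function.update h j (U / (2 * K)) i =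
          U + ∑ i, h i := by
        rw [sum_update_eq (fun _ y => y), ← Finset.add_sum_erase _ h (Finset.mem_univ j), hj]
        omega
      have key := ih (U - U / (2 * K)) (Function.update A j (List.replicate (U / (2 * K)) none))
        (Function.update φ j T) (Function.update h j (U / (2 * K)))
        ((A j).map (Option.map (Prod.mk j)) ::ₘ Cl) (by omega)
        (fun i => by
          rcases eq_or_ne i j with rfl | hij
          · simpa using hT _ (hle.trans hUN)
          · simpa [hij] using hA i)
        (by simp [hCl, holes_map, (hA j).holes_eq, hj]) (by omega)
      rw [hsum, bucketState_eq_cons] at key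
      refine SegFillable.mono ?_
        (bucketPotential_claim hK hT0 huj (v := v) (A := A) hj (hA j).listCost_le (not_lt.1 hU))
      convert key.of_split using 1
      rw [bucketState, ← Finset.add_sum_erase _ _ (Finset.mem_univ j)]
      simp only [List.map_replicate, Option.map_none, List.replicate_append_replicate]
      rw [Nat.add_sub_cancel' hle]
      congr 1
      rw [← Multiset.singleton_add, ← add_assoc, add_comm Cl]
    · push Not at hh
      have hex (j : Fin K) : ∃ f : α → ℝ, ∑ a, f a ≤ φ j * Fintype.card α ∧
          ∀ a, ∃ L', Placed a (A j) L' ∧ Fillable v (h j - 1) L' (f a) := by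
        have := hA j
        obtain ⟨m, hm⟩ := Nat.exists_eq_succ_of_ne_zero (hh j)
        rw [hm] at this ⊢
        exact this
      choose f hf A' hp hA' using hex
      have hsum (j : Fin K) : U + ∑ i, Function.update h j (h j - 1) i + 1 = U + ∑ i, h i := by
        rw [sum_update_eq (fun _ y => y), ← Finset.add_sum_erase _ h (Finset.mem_univ j)]
        have := hh j
        omega
      rw [← hsum ⟨0, by omega⟩]
      refine SegFillable.step _ (bucketPotential_item hK hh hf) fun x => ?_
      refine ⟨_, _, List.replicate U none ::ₘ
        (Cl + ∑ i ∈ Finset.univ.erase x.1, {(A i).map (Option.map (Prod.mk i))}), ?_,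
        (hp x.1 x.2).map (Prod.mk x.1), ?_⟩
      · rw [← bucketState_eq_cons, Function.update_eq_self]
      · rw [← bucketState_eq_cons]
        have e : U + ∑ i, Function.update h ⟨0, by omega⟩ (h ⟨0, by omega⟩ - 1) i =
            U + ∑ i, Function.update h x.1 (h x.1 - 1) i := by
          have h1 := hsum ⟨0, by omega⟩
          have h2 := hsum x.1
          omega
        rw [e]
        refine ih U _ _ _ Cl hUN (fun i => ?_) hCl (by have := hsum x.1; omega)
        rcases eq_or_ne i x.1 with rfl | hij
        · simpa using hA' _ x.2
        · simpa [hij] using hA i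

lemma fillable_replicate_prod (hK : 2 ≤ K) (hT0 : 0 ≤ T) (hu1 : ∀ x y, |u x - u y| ≤ 1)
    (huj : ∀ j a b, |u (j, a) - u (j, b)| = 1 / K * |v a - v b|) {N : ℕ}
    (hT : ∀ m ≤ N, Fillable v m (List.replicate m none) T) {m : ℕ} (hm : m ≤ N) :
    Fillable u m (List.replicate m none)
      (4 * T * Real.log m + (320 * K + 1284 * K * Real.log m + K + 1)) := by
  have hK0 : (2 : ℝ) ≤ K := by exact_mod_cast hK
  have key := segFillable_bucketState hK hT0 hu1 huj hT (2 * m) m (fun _ => []) (fun _ => 0)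
    (fun _ => 0) 0 hm (fun _ => ⟨rfl, le_rfl⟩) rfl (by simp)
    (List.replicate m none :: List.replicate K []) (by simp [bucketState, Multiset.nsmul_singleton, ← Multiset.cons_coe]; rfl)
  simp only [Finset.sum_const_zero, add_zero, List.flatten_cons, List.flatten_replicate_nil,
    List.append_nil] at key
  refine key.mono ?_
  have hq1 : (1 - 3 / (4 * K) : ℝ) ^ m ≤ 1 :=
    pow_le_one₀ (by rw [sub_nonneg, div_le_one (by positivity)]; linarith)
      (by rw [sub_le_self_iff]; positivity)
  have e : (T / K + 321) * (4 * K * Real.log m) = 4 * T * Real.log m + 1284 * K * Real.log m := by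
    field_simp
    ring
  simp only [bucketPotential, Multiset.map_zero, Multiset.sum_zero, Finset.sum_const_zero, e,
    Finset.sum_const, Finset.card_univ, Fintype.card_fin, nsmul_eq_mul, List.length_cons,
    List.length_replicate, pow_zero, add_zero, zero_div]
  push_cast
  have := mul_le_mul_of_nonneg_left hq1 (by positivity : (0 : ℝ) ≤ 320 * K)
  linarith

end Buckets

section Grid

lemma fillable_grid {K N : ℕ} (hK : 2 ≤ K) (d : ℕ) {m : ℕ} (hm : m ≤ N) :
    Fillable (fun i : Fin (K ^ d) => (i : ℝ) / (K ^ d : ℕ)) m (List.replicate m none)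
      (2000 * K * d * (4 * (1 + Real.log N)) ^ d) := by
  have hK0 : (2 : ℝ) ≤ K := by exact_mod_cast hK
  have hN : 0 ≤ Real.log N := Real.log_natCast_nonneg N
  induction d generalizing m with
  | zero =>
    refine (fillable_of_dist_le (δ := 0) (fun a b => ?_) le_rfl (holes_replicate m)).mono ?_
    · have : Subsingleton (Fin (K ^ 0)) := by rw [pow_zero]; infer_instance
      rw [Subsingleton.elim a b]; simp
    · simp [listCost_replicate]
  | succ d ih =>
    have hKd : 0 < K ^ d := by positivity
    have hKd' : (0 : ℝ) < (K ^ d : ℕ) := by exact_mod_cast hKd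
    have : Nonempty (Fin (K ^ d)) := ⟨⟨0, hKd⟩⟩
    set T : ℝ := 2000 * K * d * (4 * (1 + Real.log N)) ^ d with hT
    have hT0 : 0 ≤ T := by positivity
    set w : Fin (K ^ (d + 1)) → ℝ := fun i => (i : ℝ) / (K ^ (d + 1) : ℕ) with hw
    have hw1 (x y) : |w x - w y| ≤ 1 := by
      have h (x) : 0 ≤ w x ∧ w x ≤ 1 := by
        refine ⟨by positivity, ?_⟩
        rw [hw]
        refine div_le_one_of_le₀ ?_ (by positivity)
        exact_mod_cast x.2.le
      rw [abs_le]
      constructor <;> linarith [(h x).1, (h x).2, (h y).1, (h y).2]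
    let e : Fin K × Fin (K ^ d) ≃ Fin (K ^ (d + 1)) :=
      finProdFinEquiv.trans (finCongr (pow_succ' K d).symm)
    have he (j : Fin K) (a : Fin (K ^ d)) :
        w (e (j, a)) = ((j : ℝ) + (a : ℝ) / (K ^ d : ℕ)) / K := by
      simp only [hw, e, Equiv.trans_apply, finCongr_apply, Fin.val_cast, finProdFinEquiv_apply_val]
      push_cast
      field_simp
      ring
    have key := fillable_replicate_prod (u := w ∘ e)
      (v := fun i : Fin (K ^ d) => (i : ℝ) / (K ^ d : ℕ)) hK hT0 (fun x y => hw1 _ _)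
      (fun j a b => by
        have hpos : (0 : ℝ) < 1 / K := by positivity
        rw [Function.comp_apply, Function.comp_apply, he, he]
        conv_rhs => rw [← abs_of_pos hpos, ← abs_mul]
        congr 1
        field_simp
        ring) (fun m hm => ih hm) hm
    have key' := key.map_equiv (u := w) e (fun _ => rfl)
    rw [List.map_replicate, Option.map_none] at key'
    refine key'.mono ?_
    have hlog : Real.log m ≤ Real.log N := by
      rcases Nat.eq_zero_or_pos m with rfl | hm0
      · simpa using hN
      · exact Real.log_le_log (by exact_mod_cast hm0) (by exact_mod_cast hm)
    set l := 1 + Real.log N with hl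
    have hl1 : 1 ≤ l := by linarith
    have h1 : 4 * T * Real.log m ≤ 2000 * K * d * (4 * l) ^ (d + 1) := by
      calc 4 * T * Real.log m ≤ 4 * T * l := by gcongr; linarith
        _ = _ := by rw [hT, pow_succ]; ring
    have h2 : l ≤ (4 * l) ^ (d + 1) :=
      (by linarith : l ≤ 4 * l).trans (le_self_pow₀ (by linarith) (by omega))
    have h3 : 320 * K + 1284 * K * Real.log m + K + 1 ≤ 2000 * K * l := by
      have : K * Real.log m ≤ K * (l - 1) := by gcongr; linarith
      nlinarith
    have h4 : 2000 * K * l ≤ 2000 * K * (4 * l) ^ (d + 1) := by gcongr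
    push_cast
    linarith

end Grid

section Strategy

variable {α : Type*} {v : α → ℝ}

lemma Fillable.exists_strategy [Fintype α] {r : ℕ} {L : List (Option α)} {c : ℝ} (h : Fillable v r L c) :
    ∃ (F : (Fin r → α) → Fin r → ℕ) (E : (Fin r → α) → List (Option α)),
      (∀ x y k, (∀ i ≤ k, x i = y i) → F x k = F y k) ∧ (∀ x, Function.Injective (F x)) ∧
      (∀ x k, L[F x k]? = some none) ∧ (∀ x, (E x).length = L.length) ∧
      (∀ x (i : ℕ) a, L[i]? = some (some a) → (E x)[i]? = some (some a)) ∧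
      (∀ x k, (E x)[F x k]? = some (some (x k))) ∧
      ∑ x, listCost v (E x) ≤ c * (Fintype.card α : ℝ) ^ r := by
  induction r generalizing L c with
  | zero =>
    exact ⟨fun _ k => k.elim0, fun _ => L, fun _ _ k => k.elim0, fun _ k => k.elim0,
      fun _ k => k.elim0, fun _ => rfl, fun _ _ _ h => h, fun _ k => k.elim0, by simpa using h.2⟩
  | succ r ih =>
    obtain ⟨f, hf, h⟩ := h
    choose L' hp hL' using h
    choose F E hF hinj hnone hlen hE hEF hcost using fun a => ih (hL' a)
    choose l₁ l₂ hl hl' using hp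
    have hpos (a : α) : L[(l₁ a).length]? = some none := by rw [hl a]; simp
    have hpos' (a : α) : (L' a)[(l₁ a).length]? = some (some a) := by rw [hl' a]; simp
    have hne (a : α) (i : ℕ) (hi : i ≠ (l₁ a).length) : (L' a)[i]? = L[i]? := by
      rw [hl' a, hl a]
      rcases lt_or_gt_of_ne hi with h | h
      · rw [List.getElem?_append_left h, List.getElem?_append_left h]
      · rw [List.getElem?_append_right h.le, List.getElem?_append_right h.le]
        obtain ⟨m, hm⟩ := Nat.exists_eq_succ_of_ne_zero (Nat.sub_ne_zero_of_lt h)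
        simp [hm]
    have hFne (a : α) (x k) : F a x k ≠ (l₁ a).length := fun h => by
      have := hnone a x k
      rw [h, hpos'] at this
      simp at this
    refine ⟨fun x => Fin.cons (l₁ (x 0)).length (F (x 0) (Fin.tail x)),
      fun x => E (x 0) (Fin.tail x), fun x y k hxy => ?_, fun x => ?_, fun x k => ?_, fun x => ?_,
      fun x i a hi => ?_, fun x k => ?_, ?_⟩
    · have h0 : x 0 = y 0 := hxy 0 (Fin.zero_le _)
      induction k using Fin.cases with
      | zero => simp [h0]
      | succ k =>
        simp only [Fin.cons_succ, h0]
        exact hF _ _ _ _ fun i hi => hxy i.succ (Fin.succ_le_succ_iff.2 hi)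
    · rw [Fin.cons_injective_iff]
      exact ⟨fun ⟨k, hk⟩ => hFne _ _ _ hk, hinj _ _⟩
    · induction k using Fin.cases with
      | zero => simpa using hpos _
      | succ k =>
        simp only [Fin.cons_succ]
        rw [← hne _ _ (hFne (x 0) _ k)]
        exact hnone _ _ _
    · rw [hlen, hl', congrArg List.length (hl (x 0))]; simp
    · refine hE _ _ _ _ ?_
      rwa [hne]
      rintro rfl
      rw [hpos] at hi
      simp at hi
    · induction k using Fin.cases with
      | zero => simpa using hE _ _ _ _ (hpos' (x 0))
      | succ k => simpa [Fin.tail] using hEF (x 0) (Fin.tail x) k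
    · rw [← (Fin.consEquiv fun _ => α).sum_comp, Fintype.sum_prod_type]
      simp only [Fin.consEquiv_apply, Fin.cons_zero]
      calc ∑ a, ∑ x, listCost v (E a x) ≤ ∑ a, f a * (Fintype.card α : ℝ) ^ r :=
            Finset.sum_le_sum fun a _ => hcost a
        _ = (∑ a, f a) * (Fintype.card α : ℝ) ^ r := (Finset.sum_mul _ _ _).symm
        _ ≤ c * Fintype.card α * (Fintype.card α : ℝ) ^ r := by gcongr
        _ = _ := by rw [pow_succ]; ring

lemma listCost_eq_sum {n : ℕ} {l : List (Option α)} (hl : l.length = n) {b : ℕ → α}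
    (hb : ∀ j < n, l[j]? = some (some (b j))) :
    listCost v l = ∑ j ∈ Finset.range (n - 1), |v (b (j + 1)) - v (b j)| := by
  induction l generalizing n b with
  | nil => subst hl; simp [listCost]
  | cons x l ih =>
    cases l with
    | nil => subst hl; simp [listCost]
    | cons y l =>
      subst hl
      have h0 : x = some (b 0) := by simpa using hb 0 (by simp)
      have h1 : y = some (b 1) := by simpa using hb 1 (by simp)
      rw [listCost_cons_cons, ih (n := l.length + 1) (b := fun j => b (j + 1)) (by simp)
        (fun j hj => by simpa using hb (j + 1) (by simpa using hj)), h0, h1]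
      simp only [List.length_cons, Nat.add_sub_cancel, Finset.sum_range_succ' _ l.length]
      rw [add_comm, cellDist, abs_sub_comm]

end Strategy

section Discretize

/-- The index of the cell of the uniform grid of mesh `1 / M` containing a given point. -/
noncomputable def gridIndex (M : ℕ) (hM : 0 < M) (t : ℝ) : Fin M :=
  ⟨min ⌊(M : ℝ) * t⌋₊ (M - 1), by omega⟩

lemma measurable_gridIndex (M : ℕ) (hM : 0 < M) : Measurable (gridIndex M hM) := by
  have h : Measurable fun k : ℕ => (⟨min k (M - 1), by omega⟩ : Fin M) := measurable_from_nat
  exact h.comp (Nat.measurable_floor.comp (measurable_const_mul (M : ℝ)))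

lemma mem_Icc_gridIndex {M : ℕ} (hM : 0 < M) {t : ℝ} (ht : t ∈ Set.Icc (0 : ℝ) 1) :
    t ∈ Set.Icc ((gridIndex M hM t : ℝ) / M) ((gridIndex M hM t + 1 : ℝ) / M) := by
  have hM0 : (0 : ℝ) < M := by exact_mod_cast hM
  have h1 := Nat.floor_le (mul_nonneg hM0.le ht.1)
  have h2 := Nat.lt_floor_add_one ((M : ℝ) * t)
  rw [Set.mem_Icc, div_le_iff₀ hM0, le_div_iff₀ hM0, mul_comm t]
  simp only [gridIndex]
  rcases le_total ⌊(M : ℝ) * t⌋₊ (M - 1) with h | h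
  · rw [min_eq_left h]
    exact ⟨h1, h2.le⟩
  · rw [min_eq_right h]
    have h3 : ((M - 1 : ℕ) : ℝ) ≤ ⌊(M : ℝ) * t⌋₊ := by exact_mod_cast h
    rw [Nat.cast_sub (by omega)] at h3 ⊢
    push_cast at h3 ⊢
    exact ⟨by linarith, by nlinarith [ht.2]⟩

instance (n : ℕ) : IsFiniteMeasure (uniformCube n) := by
  unfold uniformCube; infer_instance

lemma integral_comp_gridIndex_le {n M : ℕ} (hM : 0 < M) {g : (Fin n → Fin M) → ℝ}
    (hg : ∀ y, 0 ≤ g y) :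
    Integrable (fun x => g fun i => gridIndex M hM (x i)) (uniformCube n) ∧
    ∫ x, g (fun i => gridIndex M hM (x i)) ∂(uniformCube n) ≤ (∑ y, g y) * (1 / M : ℝ) ^ n := by
  have hmeas : Measurable fun (x : Fin n → ℝ) (i : Fin n) => gridIndex M hM (x i) :=
    measurable_pi_lambda _ fun i => (measurable_gridIndex M hM).comp (measurable_pi_apply i)
  have hint : Integrable g ((uniformCube n).map fun x i => gridIndex M hM (x i)) :=
    Integrable.of_finite
  refine ⟨hint.comp_measurable hmeas, ?_⟩
  rw [← integral_map hmeas.aemeasurable hint.aestronglyMeasurable, integral_fintype hint,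
    Finset.sum_mul]
  refine Finset.sum_le_sum fun y _ => ?_
  rw [smul_eq_mul, mul_comm]
  refine mul_le_mul_of_nonneg_left ?_ (hg y)
  rw [Measure.real, Measure.map_apply hmeas (measurableSet_singleton y)]
  have hpre : (fun (x : Fin n → ℝ) (i : Fin n) => gridIndex M hM (x i)) ⁻¹' {y} =
      Set.univ.pi fun i => gridIndex M hM ⁻¹' {y i} := by
    ext x; simp [funext_iff]
  rw [hpre, uniformCube, Measure.pi_pi]
  refine ENNReal.toReal_le_of_le_ofReal (by positivity) ?_
  rw [ENNReal.ofReal_pow (by positivity)]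
  calc ∏ i, (volume.restrict (Set.Icc (0 : ℝ) 1)) (gridIndex M hM ⁻¹' {y i})
      ≤ ∏ _i : Fin n, ENNReal.ofReal (1 / M) := by
        refine Finset.prod_le_prod' fun i _ => ?_
        rw [Measure.restrict_apply (measurable_gridIndex M hM (measurableSet_singleton _))]
        calc volume (gridIndex M hM ⁻¹' {y i} ∩ Set.Icc (0 : ℝ) 1)
            ≤ volume (Set.Icc ((y i : ℝ) / M) ((y i + 1 : ℝ) / M)) := by
              refine measure_mono ?_
              rintro t ⟨hty : gridIndex M hM t = y i, ht⟩
              rw [← hty]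
              exact mem_Icc_gridIndex hM ht
          _ = ENNReal.ofReal (1 / M) := by
              rw [Real.volume_Icc]; congr 1; ring
    _ = _ := by simp

lemma ae_mem_Icc_uniformCube (n : ℕ) :
    ∀ᵐ x ∂(uniformCube n), ∀ i, x i ∈ Set.Icc (0 : ℝ) 1 := by
  rw [ae_all_iff]
  intro i
  exact Measure.tendsto_eval_ae_ae.eventually (ae_restrict_mem measurableSet_Icc)

lemma abs_sub_le_gridIndex {M : ℕ} (hM : 0 < M) {s t : ℝ} (hs : s ∈ Set.Icc (0 : ℝ) 1)
    (ht : t ∈ Set.Icc (0 : ℝ) 1) :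
    |s - t| ≤ |(gridIndex M hM s : ℝ) / M - (gridIndex M hM t : ℝ) / M| + 1 / M := by
  have h1 := mem_Icc_gridIndex hM hs
  have h2 := mem_Icc_gridIndex hM ht
  rw [Set.mem_Icc, add_div] at h1 h2
  set a := (gridIndex M hM s : ℝ) / M
  set b := (gridIndex M hM t : ℝ) / M
  have h3 := neg_abs_le (a - b)
  have h4 := le_abs_self (a - b)
  rw [abs_le]
  constructor <;> linarith [h1.1, h1.2, h2.1, h2.2]

lemma exists_onlineStrategy_of_fillable {n M : ℕ} (hn : 0 < n) (hnM : n ≤ M) {c : ℝ}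
    (h : Fillable (fun i : Fin M => (i : ℝ) / M) n (List.replicate n none) c) :
    ∃ S : OnlineStrategy n, ∫ x, strategyCost S x ∂(uniformCube n) ≤ c + 1 := by
  have hM : 0 < M := hn.trans_le hnM
  have hM0 : (0 : ℝ) < M := by exact_mod_cast hM
  obtain ⟨F, E, hF, hinj, hnone, hlen, -, hEF, hcost⟩ := h.exists_strategy
  have hlt (x k) : F x k < n := by
    have := hnone x k
    rw [List.getElem?_eq_some_iff] at this
    obtain ⟨h, -⟩ := this
    simpa using h
  let S : OnlineStrategy n :=
    { place := fun x k => ⟨F (fun i => gridIndex M hM (x i)) k, hlt _ _⟩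
      online := fun x y k hxy => Fin.ext <| hF _ _ _ fun i hi => by rw [hxy i hi]
      inj := fun x a b hab => hinj _ (Fin.ext_iff.1 hab)
      meas := fun k => by
        have hmeas : Measurable fun (x : Fin n → ℝ) (i : Fin n) => gridIndex M hM (x i) :=
          measurable_pi_lambda _ fun i =>
            (measurable_gridIndex M hM).comp (measurable_pi_apply i)
        have h2 : Measurable fun y : Fin n → Fin M => (⟨F y k, hlt y k⟩ : Fin n) :=
          measurable_of_finite _
        exact h2.comp hmeas }
  refine ⟨S, ?_⟩
  set g : (Fin n → Fin M) → ℝ :=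
    fun y => listCost (fun i : Fin M => (i : ℝ) / M) (E y) + 1 with hg
  have hle (x : Fin n → ℝ) (hx : ∀ i, x i ∈ Set.Icc (0 : ℝ) 1) :
      strategyCost S x ≤ g fun i => gridIndex M hM (x i) := by
    have : Nonempty (Fin n) := ⟨⟨0, hn⟩⟩
    set y : Fin n → Fin M := fun i => gridIndex M hM (x i) with hy
    have hsurj : Function.Surjective (S.place x) := Finite.surjective_of_injective (S.inj x)
    have harr (j : ℕ) (hj : j < n) : ∃ k, strategyArr S x j = x k ∧ F y k = j := by
      refine ⟨Function.invFun (S.place x) ⟨j, hj⟩, by rw [strategyArr, dif_pos hj], ?_⟩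
      exact Fin.ext_iff.1 (Function.rightInverse_invFun hsurj ⟨j, hj⟩)
    have hb (j : ℕ) (hj : j < n) :
        (E y)[j]? = some (some (gridIndex M hM (strategyArr S x j))) := by
      obtain ⟨k, hk, hFk⟩ := harr j hj
      rw [hk, ← hFk]
      exact hEF y k
    have hmem (j : ℕ) (hj : j < n) : strategyArr S x j ∈ Set.Icc (0 : ℝ) 1 := by
      obtain ⟨k, hk, -⟩ := harr j hj
      rw [hk]; exact hx k
    simp only [hg]
    rw [listCost_eq_sum (by rw [hlen, List.length_replicate]) hb, strategyCost]
    calc ∑ j ∈ Finset.range (n - 1), |strategyArr S x (j + 1) - strategyArr S x j|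
        ≤ ∑ j ∈ Finset.range (n - 1), (|(gridIndex M hM (strategyArr S x (j + 1)) : ℝ) / M -
            (gridIndex M hM (strategyArr S x j) : ℝ) / M| + 1 / M) := by
          refine Finset.sum_le_sum fun j hj => ?_
          rw [Finset.mem_range] at hj
          exact abs_sub_le_gridIndex hM (hmem _ (by omega)) (hmem _ (by omega))
      _ ≤ _ := by
          rw [Finset.sum_add_distrib]
          gcongr
          rw [Finset.sum_const, Finset.card_range, nsmul_eq_mul, mul_one_div, div_le_one hM0]
          exact_mod_cast (Nat.sub_le n 1).trans hnM
  have hg0 (y) : 0 ≤ g y := add_nonneg (listCost_nonneg _) zero_le_one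
  obtain ⟨hint, hbound⟩ := integral_comp_gridIndex_le (n := n) hM hg0
  calc ∫ x, strategyCost S x ∂(uniformCube n)
      ≤ ∫ x, g (fun i => gridIndex M hM (x i)) ∂(uniformCube n) := by
        refine integral_mono_of_nonneg (.of_forall fun x => ?_) hint ?_
        · exact Finset.sum_nonneg fun _ _ => abs_nonneg _
        · filter_upwards [ae_mem_Icc_uniformCube n] with x hx using hle x hx
    _ ≤ (∑ y, g y) * (1 / M : ℝ) ^ n := hbound
    _ ≤ ((c + 1) * (M : ℝ) ^ n) * (1 / M : ℝ) ^ n := by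
        gcongr
        simp only [hg, Finset.sum_add_distrib, Finset.sum_const, Finset.card_univ,
          Fintype.card_pi, Fintype.card_fin, Finset.prod_const, nsmul_eq_mul] at hcost ⊢
        push_cast
        linarith
    _ = c + 1 := by rw [mul_assoc, ← mul_pow, mul_one_div_cancel hM0.ne', one_pow, mul_one]

end Discretize

/-- For every `ε > 0`, stochastic online sorting admits a deterministic algorithm of
expected cost `O(n^ε)` (so expected cost `n^{o(1)}` is achievable). -/
theorem stochastic_online_sorting_subpolynomial :
    ∀ ε : ℝ, 0 < ε → ∃ C : ℝ, 0 < C ∧ ∀ n : ℕ, 2 ≤ n → ∃ S : OnlineStrategy n,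
      ∫ x, strategyCost S x ∂(uniformCube n) ≤ C * (n : ℝ) ^ ε := by
  intro ε hε
  set s : ℝ := ε / 2 with hs
  have hs0 : 0 < s := by positivity
  set d : ℕ := ⌈1 / s⌉₊ with hd
  have hd0 : 0 < d := Nat.ceil_pos.2 (by positivity)
  have hd0' : (0 : ℝ) < d := by exact_mod_cast hd0
  have hsd : 1 ≤ s * d := by
    have := Nat.le_ceil (1 / s)
    rw [div_le_iff₀ hs0] at this
    rw [mul_comm]; exact this
  set t : ℝ := s / d with ht
  have ht0 : 0 < t := by positivity
  refine ⟨4000 * d * (4 * (1 + 1 / t)) ^ d + 1, by positivity, fun n hn => ?_⟩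
  have hn1 : (1 : ℝ) < n := by exact_mod_cast (by omega : 1 < n)
  have hn0 : (0 : ℝ) ≤ n := by positivity
  have hns : 1 < (n : ℝ) ^ s := Real.one_lt_rpow hn1 hs0
  have hnt : 1 < (n : ℝ) ^ t := Real.one_lt_rpow hn1 ht0
  set K : ℕ := ⌈(n : ℝ) ^ s⌉₊ with hK
  have hK2 : 2 ≤ K := Nat.lt_ceil.2 (by simpa using hns)
  have hKle : (K : ℝ) ≤ 2 * (n : ℝ) ^ s := by
    have := Nat.ceil_lt_add_one (by positivity : 0 ≤ (n : ℝ) ^ s)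
    linarith
  have hnK : n ≤ K ^ d := by
    have : (n : ℝ) ≤ (K : ℝ) ^ d := by
      calc (n : ℝ) = (n : ℝ) ^ (1 : ℝ) := (Real.rpow_one _).symm
        _ ≤ (n : ℝ) ^ (s * d) := Real.rpow_le_rpow_of_exponent_le hn1.le hsd
        _ = ((n : ℝ) ^ s) ^ d := by rw [Real.rpow_mul hn0, Real.rpow_natCast]
        _ ≤ (K : ℝ) ^ d := by gcongr; exact Nat.le_ceil _
    exact_mod_cast this
  obtain ⟨S, hS⟩ := exists_onlineStrategy_of_fillable (by omega) hnK
    (fillable_grid hK2 d (le_refl n))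
  refine ⟨S, hS.trans ?_⟩
  have hlog : 1 + Real.log n ≤ (1 + 1 / t) * (n : ℝ) ^ t := by
    have := Real.log_le_rpow_div hn0 ht0
    rw [add_mul, one_mul, one_div, inv_mul_eq_div]
    linarith
  have hlog0 : 0 ≤ Real.log n := Real.log_natCast_nonneg n
  have hpow : (4 * (1 + Real.log n)) ^ d ≤ (4 * (1 + 1 / t)) ^ d * (n : ℝ) ^ s := by
    calc (4 * (1 + Real.log n)) ^ d ≤ (4 * ((1 + 1 / t) * (n : ℝ) ^ t)) ^ d := by gcongr
      _ = (4 * (1 + 1 / t)) ^ d * ((n : ℝ) ^ t) ^ d := by rw [← mul_assoc, mul_pow]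
      _ = _ := by
        rw [← Real.rpow_natCast ((n : ℝ) ^ t), ← Real.rpow_mul hn0, ht, div_mul_cancel₀ _ hd0'.ne']
  have hsplit : (n : ℝ) ^ ε = (n : ℝ) ^ s * (n : ℝ) ^ s := by
    rw [← Real.rpow_add (by linarith), hs, add_halves]
  have h1 : 1 ≤ (n : ℝ) ^ ε := (Real.one_lt_rpow hn1 hε).le
  calc 2000 * K * d * (4 * (1 + Real.log n)) ^ d + 1
      ≤ 2000 * (2 * (n : ℝ) ^ s) * d * ((4 * (1 + 1 / t)) ^ d * (n : ℝ) ^ s) + (n : ℝ) ^ ε := by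
        gcongr
    _ = _ := by rw [hsplit]; ring
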